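/- Let n ∈ ℕ and p, q ∈ ℕ with p + q < n. Then the inclusion 𝒞_{p,q} ↪ 𝒰 := 𝒞_{p+1,q} ∪ 𝒞_{p,q} ∪ 𝒞_{p,q+1} induces the trivial homomorphism of fundamental groups: for every a ∈ 𝒞_{p,q} and every loop γ : [0,1] → 𝒞_{p,q} with γ(0) = γ(1) = a, the loop γ regarded as a loop in the subspace 𝒰 is path-homotopic (with endpoints fixed, within 𝒰) to the constant loop at a. -/

import Mathlib

open Matrix

/-- The diagonal matrix `D_{p,q}` with `p` entries `1`, then `q` entries `−1`, then zeros. -/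
def signatureDiag (n p q : ℕ) : Matrix (Fin n) (Fin n) ℝ :=
  Matrix.diagonal (fun i => if (i : ℕ) < p then (1 : ℝ) else if (i : ℕ) < p + q then -1 else 0)

/-- The cone `𝒞_{p,q}` of real symmetric `n×n` matrices of signature `(p,q)`. -/
def sigCone (n p q : ℕ) : Set (Matrix (Fin n) (Fin n) ℝ) :=
  {x | ∃ g : Matrix (Fin n) (Fin n) ℝ, IsUnit g ∧ x = g * signatureDiag n p q * gᵀ}

open unitInterval

theorem aux_null0 {X : Type*} [TopologicalSpace X] {x x' c c' : X} (P : Path x x')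
    (D0 : Path x c) (D1 : Path x' c') (Q : Path c c')
    (h : (P.trans D1).Homotopic (D0.trans Q)) (hx : x' = x) (hc : c' = c)
    (hD : ∀ t, D1 t = D0 t) (hQ : ∀ t, Q t = c) (y : X) (hy : y = x) (γ : Path y y)
    (hγ : ∀ t, γ t = P t) : γ.Homotopic (Path.refl y) := by
  subst hx hc hy
  obtain rfl : D1 = D0 := by ext t; exact hD t
  obtain rfl : γ = P := by ext t; exact hγ t
  obtain rfl : Q = Path.refl _ := by ext t; exact hQ t
  rw [← Path.Homotopic.Quotient.eq] at h ⊢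
  simp only [Path.Homotopic.Quotient.mk_trans, Path.Homotopic.Quotient.mk_refl,
    Path.Homotopic.Quotient.trans_refl] at h ⊢
  have h2 := congrArg (fun z => Path.Homotopic.Quotient.trans z
    (Path.Homotopic.Quotient.mk D1).symm) h
  simpa [Path.Homotopic.Quotient.trans_assoc] using h2

theorem aux_null {X : Type*} [TopologicalSpace X] {x c : X} (γ : Path x x)
    (h : ContinuousMap.HomotopicWith γ.toContinuousMap (ContinuousMap.const I c)
      (fun f => f 0 = f 1)) : γ.Homotopic (Path.refl x) := by
  obtain ⟨H⟩ := h
  have hk := Path.Homotopic.map_trans_evalAt H.toHomotopy unitInterval.path01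
  refine aux_null0 _ _ _ _ hk ?_ ?_ ?_ ?_ x ?_ γ ?_
  · simp
  · simp
  · intro t; exact (H.prop' t).symm
  · intro t; rfl
  · simp
  · intro t; rfl

/-- Path connected total space. -/
theorem aux_section {E : Type*} [TopologicalSpace E] (O : I → Set E)
    (hpc : ∀ t, ∀ x ∈ O t, ∀ y ∈ O t, JoinedIn (O t) x y)
    (hloc : ∀ t, ∃ z, ∀ᶠ s in nhds t, z ∈ O s) (x0 x1 : E) (h0 : x0 ∈ O 0) (h1 : x1 ∈ O 1) :
    ∃ (τ : I → I) (y : I → E), Continuous τ ∧ Continuous y ∧ τ 0 = 0 ∧ τ 1 = 1 ∧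
      y 0 = x0 ∧ y 1 = x1 ∧ ∀ t, y t ∈ O (τ t) := by
  let T : Set (I × E) := {z | z.2 ∈ O z.1}
  have hfib : ∀ t, ∀ x ∈ O t, ∀ y ∈ O t, JoinedIn T (t, x) (t, y) := by
    intro t x hx y hy
    obtain ⟨p, hp⟩ := hpc t x hx y hy
    exact ⟨(Path.refl t).prod p, fun s => hp s⟩
  have key : ∀ t : I, ∀ x ∈ O t, JoinedIn T (0, x0) (t, x) := by
    have : LocallyPathConnectedSpace I := (convex_Icc (0 : ℝ) 1).locallyPathConnectedSpace
    let A : Set I := {t | ∀ x ∈ O t, JoinedIn T (0, x0) (t, x)}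
    have hl : ∀ t : I, ∃ N ∈ nhds t, ∀ a ∈ N, ∀ b ∈ N, a ∈ A → b ∈ A := by
      intro t
      obtain ⟨z, hz⟩ := hloc t
      obtain ⟨N, ⟨hN, hNc⟩, hNz⟩ :=
        (LocallyPathConnectedSpace.path_connected_basis t).mem_iff.1 hz
      refine ⟨N, hN, fun a ha b hb hA x hx => ?_⟩
      have j1 := hA z (hNz ha)
      obtain ⟨p, hp⟩ := hNc.joinedIn a ha b hb
      have j2 : JoinedIn T (a, z) (b, z) := ⟨p.prod (Path.refl z), fun s => hNz (hp s)⟩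
      exact (j1.trans j2).trans (hfib b z (hNz hb) x hx)
    have hA : IsClopen A := by
      constructor
      · rw [← isOpen_compl_iff, isOpen_iff_mem_nhds]
        intro t ht
        obtain ⟨N, hN, h⟩ := hl t
        filter_upwards [hN] with a ha hA
        exact ht (h a ha t (mem_of_mem_nhds hN) hA)
      · rw [isOpen_iff_mem_nhds]
        intro t ht
        obtain ⟨N, hN, h⟩ := hl t
        filter_upwards [hN] with a ha
        exact h t (mem_of_mem_nhds hN) a ha ht
    have : A = Set.univ := hA.eq_univ ⟨0, fun x hx => hfib 0 x0 h0 x hx⟩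
    intro t
    have : t ∈ A := by rw [this]; trivial
    exact this
  obtain ⟨p, hp⟩ := key 1 x1 h1
  exact ⟨fun t => (p t).1, fun t => (p t).2, by fun_prop, by fun_prop, by simp, by simp,
    by simp, by simp, hp⟩

section FH
variable {n : ℕ}

/-- Free homotopy of loops inside a set of matrices. -/
def FH (U : Set (Matrix (Fin n) (Fin n) ℝ)) (f g : I → Matrix (Fin n) (Fin n) ℝ) : Prop :=
  ∃ (f' g' : C(I, U)), (∀ t, (f' t : Matrix (Fin n) (Fin n) ℝ) = f t) ∧
    (∀ t, (g' t : Matrix (Fin n) (Fin n) ℝ) = g t) ∧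
    ContinuousMap.HomotopicWith f' g' (fun f => f 0 = f 1)

theorem FH.mk {U : Set (Matrix (Fin n) (Fin n) ℝ)} {f g : I → Matrix (Fin n) (Fin n) ℝ}
    (H : ℝ → I → Matrix (Fin n) (Fin n) ℝ)
    (hc : Continuous (fun z : I × I => H z.1 z.2))
    (hU : ∀ s : ℝ, 0 ≤ s → s ≤ 1 → ∀ t, H s t ∈ U) (h01 : ∀ s, H s 0 = H s 1)
    (hf : ∀ t, H 0 t = f t) (hg : ∀ t, H 1 t = g t) : FH U f g := by
  let F : C(I × I, U) := ⟨fun z => ⟨H z.1 z.2, hU z.1 z.1.2.1 z.1.2.2 z.2⟩,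
    hc.subtype_mk _⟩
  refine ⟨⟨fun t => F (0, t), by fun_prop⟩, ⟨fun t => F (1, t), by fun_prop⟩, ?_, ?_, ?_⟩
  · intro t; simpa [F] using hf t
  · intro t; simpa [F] using hg t
  · refine ⟨⟨⟨F, fun t => rfl, fun t => rfl⟩, ?_⟩⟩
    intro s
    apply Subtype.ext
    exact h01 _

theorem FH.trans {U : Set (Matrix (Fin n) (Fin n) ℝ)} {f g h : I → Matrix (Fin n) (Fin n) ℝ}
    (h1 : FH U f g) (h2 : FH U g h) : FH U f h := by
  obtain ⟨a, b, ha, hb, hab⟩ := h1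
  obtain ⟨b', c, hb', hc, hbc⟩ := h2
  have : b = b' := by ext t; rw [hb, hb']
  subst this
  exact ⟨a, c, ha, hc, hab.trans hbc⟩

theorem FH.map {m : ℕ} {U : Set (Matrix (Fin n) (Fin n) ℝ)} {V : Set (Matrix (Fin m) (Fin m) ℝ)}
    {f g : I → Matrix (Fin n) (Fin n) ℝ}
    (Φ : Matrix (Fin n) (Fin n) ℝ → Matrix (Fin m) (Fin m) ℝ) (hΦ : Continuous Φ)
    (hUV : ∀ x ∈ U, Φ x ∈ V) (h1 : FH U f g) : FH V (fun t => Φ (f t)) (fun t => Φ (g t)) := by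
  obtain ⟨a, b, ha, hb, ⟨H⟩⟩ := h1
  let Ψ : C(U, V) := ⟨fun x => ⟨Φ x, hUV x x.2⟩, by fun_prop⟩
  refine ⟨Ψ.comp a, Ψ.comp b, by simp [Ψ, ha], by simp [Ψ, hb], ⟨⟨⟨Ψ.comp H.toContinuousMap, ?_, ?_⟩, ?_⟩⟩⟩
  · intro t; simp
  · intro t; simp
  · intro s
    have := H.prop' s
    exact congrArg Ψ this

theorem FH.reparam {U : Set (Matrix (Fin n) (Fin n) ℝ)} {f : I → Matrix (Fin n) (Fin n) ℝ}
    (hf : Continuous f) (hU : ∀ t, f t ∈ U) (h01 : f 0 = f 1) (τ : I → I) (hτ : Continuous τ)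
    (h0 : τ 0 = 0) (h1 : τ 1 = 1) : FH U f (fun t => f (τ t)) := by
  refine FH.mk (fun s t => f (Set.projIcc 0 1 zero_le_one ((1 - s) * t + s * τ t))) ?_ ?_ ?_ ?_ ?_
  · refine hf.comp (continuous_projIcc.comp ?_)
    fun_prop
  · intro s _ _ t; exact hU _
  · intro s; simp [h0, h1, h01]
  · intro t; simp
  · intro t; simp

end FH


section Sig
variable {n : ℕ}

/-- Signs. -/
def sgn {α β : Type*} : α ⊕ β → ℝ := Sum.elim (fun _ => 1) (fun _ => -1)

theorem sgn_ne {α β : Type*} (i : α ⊕ β) : sgn i ≠ 0 := by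
  cases i <;> simp [sgn]

/-- Weighted sum of rank one matrices. -/
def frm {ι : Type*} [Fintype ι] (c : ι → ℝ) (v : ι → Fin n → ℝ) : Matrix (Fin n) (Fin n) ℝ :=
  ∑ i, c i • vecMulVec (v i) (v i)

/-- Signature predicate. -/
def Sig (x : Matrix (Fin n) (Fin n) ℝ) (p q : ℕ) : Prop :=
  ∃ v : Fin p ⊕ Fin q → Fin n → ℝ, LinearIndependent ℝ v ∧ x = frm sgn v

theorem frm_mulVec {ι : Type*} [Fintype ι] (c : ι → ℝ) (v : ι → Fin n → ℝ) (y : Fin n → ℝ) :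
    frm c v *ᵥ y = ∑ i, (c i * (v i ⬝ᵥ y)) • v i := by
  simp only [frm, Matrix.sum_mulVec, smul_mulVec, vecMulVec_mulVec]
  refine Finset.sum_congr rfl fun i _ => ?_
  ext j
  simp
  ring

theorem frm_ker {ι : Type*} [Fintype ι] {c : ι → ℝ} {v : ι → Fin n → ℝ} {y : Fin n → ℝ}
    (hv : LinearIndependent ℝ v) (hc : ∀ i, c i ≠ 0) (h : frm c v *ᵥ y = 0) (i : ι) :
    v i ⬝ᵥ y = 0 := by
  rw [frm_mulVec] at h
  have := Fintype.linearIndependent_iff.1 hv _ h i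
  simpa [hc i] using this

theorem frm_conj {m : ℕ} {ι : Type*} [Fintype ι] (c : ι → ℝ) (v : ι → Fin n → ℝ)
    (K : Matrix (Fin m) (Fin n) ℝ) : K * frm c v * Kᵀ = frm c (fun i => K *ᵥ v i) := by
  simp only [frm, Matrix.mul_sum, Matrix.sum_mul]
  refine Finset.sum_congr rfl fun i _ => ?_
  rw [Matrix.mul_smul, Matrix.smul_mul, mul_vecMulVec, vecMulVec_mul, vecMul_transpose]

theorem frm_symm {ι : Type*} [Fintype ι] (c : ι → ℝ) (v : ι → Fin n → ℝ) :
    (frm c v)ᵀ = frm c v := by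
  simp [frm, transpose_sum, transpose_smul, transpose_vecMulVec]

theorem frm_equiv {ι κ : Type*} [Fintype ι] [Fintype κ] (e : κ ≃ ι) (c : ι → ℝ)
    (v : ι → Fin n → ℝ) : frm (fun k => c (e k)) (fun k => v (e k)) = frm c v :=
  e.sum_comp (fun i => c i • vecMulVec (v i) (v i))

theorem Sig.of {α β : Type*} [Fintype α] [Fintype β] {p q : ℕ} (hp : Fintype.card α = p)
    (hq : Fintype.card β = q) (v : α ⊕ β → Fin n → ℝ) (hv : LinearIndependent ℝ v) :
    Sig (frm sgn v) p q := by
  let e : Fin p ⊕ Fin q ≃ α ⊕ β :=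
    Equiv.sumCongr (Fintype.equivFinOfCardEq hp).symm (Fintype.equivFinOfCardEq hq).symm
  refine ⟨fun k => v (e k), hv.comp e e.injective, ?_⟩
  rw [← frm_equiv e]
  congr 1
  ext k
  cases k <;> rfl

theorem Sig.symm {x : Matrix (Fin n) (Fin n) ℝ} {p q : ℕ} (h : Sig x p q) : xᵀ = x := by
  obtain ⟨v, hv, rfl⟩ := h
  exact frm_symm _ _

theorem dot_span_zero {s : Set (Fin n → ℝ)} {y z : Fin n → ℝ} (hs : ∀ v ∈ s, v ⬝ᵥ y = 0)
    (hz : z ∈ Submodule.span ℝ s) : z ⬝ᵥ y = 0 := by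
  induction hz using Submodule.span_induction with
  | mem x h => exact hs x h
  | zero => simp
  | add x y _ _ h1 h2 => simp [add_dotProduct, h1, h2]
  | smul a x _ h => simp [smul_dotProduct, h]

theorem Sig.add {R : Matrix (Fin n) (Fin n) ℝ} {p q : ℕ} (h : Sig R p q) (y z : Fin n → ℝ)
    (hy : R *ᵥ y = 0) (hz : z ⬝ᵥ y ≠ 0) : Sig (R + vecMulVec z z) (p + 1) q := by
  obtain ⟨v, hv, rfl⟩ := h
  have hk := frm_ker hv sgn_ne hy
  let e : Option (Fin p) ⊕ Fin q ≃ Option (Fin p ⊕ Fin q) :=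
    { toFun := Sum.elim (fun o => o.map Sum.inl) (fun j => some (Sum.inr j))
      invFun := fun o => o.elim (Sum.inl none) (Sum.elim (fun i => Sum.inl (some i)) Sum.inr)
      left_inv := by rintro ((_|_)|_) <;> rfl
      right_inv := by rintro (_|(_|_)) <;> rfl }
  let v' : Option (Fin p ⊕ Fin q) → Fin n → ℝ := fun o => o.elim z v
  have hv' : LinearIndependent ℝ v' := by
    rw [linearIndependent_option]
    refine ⟨hv, fun hm => hz (dot_span_zero ?_ hm)⟩
    rintro _ ⟨i, rfl⟩
    exact hk i
  have := Sig.of (p := p + 1) (q := q) (by simp) (by simp) (fun k => v' (e k))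
    (hv'.comp e e.injective)
  convert this using 1
  simp [frm, Fintype.sum_option, sgn, e, v']
  abel

theorem Sig.conj {m : ℕ} {R : Matrix (Fin n) (Fin n) ℝ} {p q : ℕ} (h : Sig R p q)
    (K : Matrix (Fin m) (Fin n) ℝ) (u y : Fin n → ℝ) (hK : ∀ x, K *ᵥ x = 0 → ∃ c : ℝ, x = c • u)
    (hy : R *ᵥ y = 0) (hu : u ⬝ᵥ y ≠ 0) : Sig (K * R * Kᵀ) p q := by
  obtain ⟨v, hv, rfl⟩ := h
  have hk := frm_ker hv sgn_ne hy
  refine ⟨fun i => K *ᵥ v i, ?_, frm_conj _ _ _⟩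
  have := hv.map (f := K.mulVecLin) ?_
  · exact this
  · rw [Submodule.disjoint_def]
    intro x hx hx'
    obtain ⟨c, rfl⟩ := hK x (by simpa using hx')
    have : (c • u) ⬝ᵥ y = 0 := by
      refine dot_span_zero ?_ hx
      rintro _ ⟨i, rfl⟩
      exact hk i
    have : c = 0 := by simpa [smul_dotProduct, hu] using this
    simp [this]

theorem Sig.conj_inj {m : ℕ} {R : Matrix (Fin n) (Fin n) ℝ} {p q : ℕ} (h : Sig R p q)
    (K : Matrix (Fin m) (Fin n) ℝ) (hK : ∀ x, K *ᵥ x = 0 → x = 0) : Sig (K * R * Kᵀ) p q := by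
  obtain ⟨v, hv, rfl⟩ := h
  refine ⟨fun i => K *ᵥ v i, ?_, frm_conj _ _ _⟩
  have := hv.map (f := K.mulVecLin) ?_
  · exact this
  · rw [Submodule.disjoint_def]
    intro x hx hx'
    exact hK x (by simpa using hx')

theorem Sig.neg {x : Matrix (Fin n) (Fin n) ℝ} {p q : ℕ} (h : Sig x p q) : Sig (-x) q p := by
  obtain ⟨v, hv, rfl⟩ := h
  refine ⟨fun k => v (Equiv.sumComm _ _ k), hv.comp _ (Equiv.sumComm _ _).injective, ?_⟩
  simp [frm, sgn]

theorem frm_quad {ι : Type*} [Fintype ι] (c : ι → ℝ) (v : ι → Fin n → ℝ) (y : Fin n → ℝ) :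
    y ⬝ᵥ (frm c v *ᵥ y) = ∑ i, c i * (v i ⬝ᵥ y) ^ 2 := by
  rw [frm_mulVec, dotProduct_sum]
  refine Finset.sum_congr rfl fun i _ => ?_
  rw [dotProduct_smul, dotProduct_comm, smul_eq_mul]; ring

theorem mem_span_of_dot {ι : Type*} [Fintype ι] (w : ι → Fin n → ℝ) (z : Fin n → ℝ)
    (h : ∀ y, (∀ i, w i ⬝ᵥ y = 0) → z ⬝ᵥ y = 0) : z ∈ Submodule.span ℝ (Set.range w) := by
  let D := dotProductEquiv ℝ (Fin n)
  have := mem_span_of_iInf_ker_le_ker (L := fun i => D (w i)) (K := D z) (by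
    intro y hy
    simp only [Submodule.mem_iInf, LinearMap.mem_ker] at hy ⊢
    exact h y hy)
  have h2 : D z ∈ (Submodule.span ℝ (Set.range w)).map D.toLinearMap := by
    rw [Submodule.map_span, ← Set.range_comp]
    exact this
  obtain ⟨z', hz', e⟩ := h2
  rwa [D.injective e] at hz'

theorem Sig.le {x : Matrix (Fin n) (Fin n) ℝ} {p q p' q' : ℕ} (h : Sig x p q) (h' : Sig x p' q') :
    p ≤ p' := by
  obtain ⟨v, hv, rfl⟩ := h
  obtain ⟨v', hv', e⟩ := h'
  let w : Fin p' ⊕ Fin q → Fin n → ℝ := Sum.elim (fun i => v' (Sum.inl i)) (fun j => v (Sum.inr j))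
  have hs : Submodule.span ℝ (Set.range v) ≤ Submodule.span ℝ (Set.range w) := by
    rw [Submodule.span_le]
    rintro _ ⟨i, rfl⟩
    refine mem_span_of_dot _ _ fun y hy => ?_
    rcases i with i | j
    swap
    · exact hy (Sum.inr j)
    have h1 := frm_quad sgn v y
    rw [e, frm_quad sgn v' y] at h1
    have a1 : ∀ i, v' (Sum.inl i) ⬝ᵥ y = 0 := fun i => hy (Sum.inl i)
    have a2 : ∀ i, v (Sum.inr i) ⬝ᵥ y = 0 := fun i => hy (Sum.inr i)
    simp [sgn, a1, a2] at h1
    have b1 : 0 ≤ ∑ i, (v' (Sum.inr i) ⬝ᵥ y) ^ 2 := Finset.sum_nonneg fun i _ => sq_nonneg _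
    have b2 : ∑ i, (v (Sum.inl i) ⬝ᵥ y) ^ 2 = 0 :=
      le_antisymm (by linarith) (Finset.sum_nonneg fun i _ => sq_nonneg _)
    rw [Finset.sum_eq_zero_iff_of_nonneg (fun i _ => sq_nonneg _)] at b2
    simpa using b2 i (Finset.mem_univ _)
  have h1 := finrank_span_eq_card hv
  have h2 := finrank_range_le_card (R := ℝ) w
  have h3 := Submodule.finrank_mono hs
  simp [Set.finrank] at h1 h2
  omega

theorem Sig.unique {x : Matrix (Fin n) (Fin n) ℝ} {p q p' q' : ℕ} (h : Sig x p q)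
    (h' : Sig x p' q') : p = p' ∧ q = q' :=
  ⟨le_antisymm (h.le h') (h'.le h), le_antisymm (h.neg.le h'.neg) (h'.neg.le h.neg)⟩

theorem frm_diag (g : Matrix (Fin n) (Fin n) ℝ) (c : Fin n → ℝ) :
    g * diagonal c * gᵀ = frm c (fun i j => g j i) := by
  ext i j
  rw [mul_apply]
  simp only [mul_diagonal, transpose_apply, frm, Matrix.sum_apply, Matrix.smul_apply,
    vecMulVec_apply, smul_eq_mul]
  exact Finset.sum_congr rfl fun k _ => by ring

theorem Sig.exists {x : Matrix (Fin n) (Fin n) ℝ} (hx : xᵀ = x) : ∃ p q, Sig x p q := by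
  have hH : x.IsHermitian := by simpa [IsHermitian, conjTranspose_eq_transpose_of_trivial] using hx
  obtain ⟨c, v, hv, rfl⟩ : ∃ (c : Fin n → ℝ) (v : Fin n → Fin n → ℝ), LinearIndependent ℝ v ∧
      x = frm c v := by
    refine ⟨hH.eigenvalues, fun i => WithLp.ofLp (hH.eigenvectorBasis i), ?_, ?_⟩
    · have := hH.eigenvectorBasis.toBasis.linearIndependent.map'
        (WithLp.linearEquiv 2 ℝ (Fin n → ℝ)).toLinearMap (LinearEquiv.ker _)
      exact this
    · have h1 := hH.spectral_theorem
      rw [Unitary.conjStarAlgAut_apply] at h1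
      refine h1.trans ?_
      have := frm_diag (hH.eigenvectorUnitary : Matrix (Fin n) (Fin n) ℝ) hH.eigenvalues
      exact this
  refine ⟨Fintype.card {i // 0 < c i}, Fintype.card {i // c i < 0}, ?_⟩
  let f : {i // 0 < c i} ⊕ {i // c i < 0} → Fin n := Sum.elim (fun i => i.1) (fun i => i.1)
  have hf : Function.Injective f := by
    rintro (⟨i, hi⟩ | ⟨i, hi⟩) (⟨j, hj⟩ | ⟨j, hj⟩) h <;> simp [f] at h <;> subst h <;>
      first | rfl | (exfalso; linarith)
  have hs : ∀ k, Real.sqrt |c (f k)| ≠ 0 := by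
    rintro (⟨i, hi⟩ | ⟨i, hi⟩)
    · simp [f, hi.ne']
    · simp [f, hi.ne]
  have key : frm c v = frm sgn (fun k => Real.sqrt |c (f k)| • v (f k)) := by
    have h1 : ∀ k, sgn k • vecMulVec (Real.sqrt |c (f k)| • v (f k)) (Real.sqrt |c (f k)| • v (f k))
        = c (f k) • vecMulVec (v (f k)) (v (f k)) := by
      intro k
      rw [smul_vecMulVec, vecMulVec_smul, smul_smul, smul_smul]
      congr 1
      rw [mul_assoc, Real.mul_self_sqrt (abs_nonneg _)]
      rcases k with ⟨i, hi⟩ | ⟨i, hi⟩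
      · simp [sgn, f, abs_of_pos hi]
      · simp [sgn, f, abs_of_neg hi]
    unfold frm
    rw [Finset.sum_congr rfl fun k _ => h1 k]
    symm
    refine Finset.sum_of_injOn f hf.injOn (by simp) ?_ (by simp)
    intro i _ hi
    have : c i = 0 := by
      by_contra h0
      apply hi
      rcases lt_or_gt_of_ne h0 with h | h
      · exact ⟨Sum.inr ⟨i, h⟩, by simp, rfl⟩
      · exact ⟨Sum.inl ⟨i, h⟩, by simp, rfl⟩
    simp [this]
  rw [key]
  exact Sig.of rfl rfl _ ((hv.comp f hf).units_smul (fun k => Units.mk0 _ (hs k)))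

theorem Sig.of_sigCone {x : Matrix (Fin n) (Fin n) ℝ} {p q : ℕ} (hpq : p + q ≤ n)
    (h : x ∈ sigCone n p q) : Sig x p q := by
  obtain ⟨g, hg, rfl⟩ := h
  rw [signatureDiag, frm_diag]
  have hv : LinearIndependent ℝ (fun i j => g j i) :=
    Matrix.linearIndependent_rows_of_isUnit (A := gᵀ) ((Matrix.isUnit_transpose g).2 hg)
  let f : Fin p ⊕ Fin q → Fin n :=
    Sum.elim (fun i => ⟨i, by omega⟩) (fun j => ⟨p + j, by omega⟩)
  have hf : Function.Injective f := by
    rintro (i | i) (j | j) h <;> simp [f] at h <;> simp <;> omega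
  refine ⟨fun k => fun j => g j (f k), hv.comp f hf, ?_⟩
  unfold frm
  symm
  refine Finset.sum_of_injOn f hf.injOn (by simp) ?_ ?_
  · intro i _ hi
    have h1 : ¬ (i : ℕ) < p := fun h => hi ⟨Sum.inl ⟨i, h⟩, by simp, rfl⟩
    have h2 : ¬ (i : ℕ) < p + q := fun h => hi ⟨Sum.inr ⟨i - p, by omega⟩, by simp, by
      ext; simp [f]; omega⟩
    simp [h1, h2]
  · rintro (i | i) _ <;> simp [f, sgn]

theorem Sig.to_sigCone {x : Matrix (Fin n) (Fin n) ℝ} {p q : ℕ} (h : Sig x p q) :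
    x ∈ sigCone n p q := by
  obtain ⟨v, hv, rfl⟩ := h
  have hle : p + q ≤ n := by
    have := hv.fintype_card_le_finrank
    simpa using this
  let b := Module.Basis.sumExtend hv
  have hb : ∀ i, b (Sum.inl i) = v i := by
    intro i; simp [b, Module.Basis.sumExtend]; rfl
  have hfin : Finite ((Fin p ⊕ Fin q) ⊕ Module.Basis.sumExtendIndex hv) := Module.Finite.finite_basis b
  have hfin2 : Finite (Module.Basis.sumExtendIndex hv) :=
    Finite.of_injective (Sum.inr : _ → (Fin p ⊕ Fin q) ⊕ Module.Basis.sumExtendIndex hv) Sum.inr_injective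
  have : Fintype (Module.Basis.sumExtendIndex hv) := Fintype.ofFinite _
  have hcard : Fintype.card (Module.Basis.sumExtendIndex hv) = n - (p + q) := by
    have := Module.finrank_eq_card_basis b
    rw [Fintype.card_sum, Fintype.card_sum, Fintype.card_fin, Fintype.card_fin,
      Module.finrank_fin_fun] at this
    omega
  let e : (Fin p ⊕ Fin q) ⊕ Module.Basis.sumExtendIndex hv ≃ Fin n :=
    (Equiv.sumCongr finSumFinEquiv (Fintype.equivFinOfCardEq hcard)).trans
      (finSumFinEquiv.trans (finCongr (by omega)))
  let g : Matrix (Fin n) (Fin n) ℝ := fun j i => b (e.symm i) j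
  have hg : IsUnit g := by
    rw [← Matrix.isUnit_transpose, ← Matrix.linearIndependent_rows_iff_isUnit]
    exact b.linearIndependent.comp e.symm e.symm.injective
  refine ⟨g, hg, ?_⟩
  rw [signatureDiag, frm_diag, ← frm_equiv e]
  have e1 : ∀ i, ((e (Sum.inl (Sum.inl i)) : Fin n) : ℕ) = i := fun i => by simp [e]
  have e2 : ∀ i, ((e (Sum.inl (Sum.inr i)) : Fin n) : ℕ) = p + i := fun i => by simp [e]
  have e3 : ∀ i, p + q ≤ ((e (Sum.inr i) : Fin n) : ℕ) := fun i => by simp [e]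
  have e3' : ∀ i, ¬ ((e (Sum.inr i) : Fin n) : ℕ) < p := fun i => by have := e3 i; omega
  have e3'' : ∀ i, ¬ ((e (Sum.inr i) : Fin n) : ℕ) < p + q := fun i => by have := e3 i; omega
  simp only [frm, Fintype.sum_sum_type]
  simp [e1, e2, e3', e3'', g, hb, sgn]

end Sig


section Proj
variable {n : ℕ}

/-- The kernel projection of a symmetric matrix with `k`-dimensional kernel. -/
noncomputable def projK (k : ℕ) (R : Matrix (Fin n) (Fin n) ℝ) : Matrix (Fin n) (Fin n) ℝ :=
  (R.charpoly.coeff k)⁻¹ • ∑ j ∈ Finset.range (n + 1), R.charpoly.coeff (j + k) • R ^ j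

theorem continuous_charpoly_coeff (j : ℕ) :
    Continuous (fun R : Matrix (Fin n) (Fin n) ℝ => R.charpoly.coeff j) := by
  have : ∀ R : Matrix (Fin n) (Fin n) ℝ, R.charpoly.coeff j =
      MvPolynomial.eval (fun ij : Fin n × Fin n => R ij.1 ij.2)
        ((Matrix.charpoly.univ ℝ (Fin n)).coeff j) := by
    intro R
    exact (Matrix.charpoly.univ_coeff_eval₂Hom (Fin n) (RingHom.id ℝ)
      (fun ij : Fin n × Fin n => R ij.1 ij.2) j).symm
  simp only [this]
  refine (MvPolynomial.continuous_eval _).comp ?_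
  fun_prop

theorem pow_ker {R M : Matrix (Fin n) (Fin n) ℝ} (hR : Rᵀ = R) (k : ℕ) (h : R ^ k * M = 0) :
    R * M = 0 := by
  have hH : Rᴴ = R := by rw [conjTranspose_eq_transpose_of_trivial, hR]
  cases k with
  | zero => simp at h; simp [h]
  | succ k =>
    induction k with
    | zero => simpa using h
    | succ k ih =>
      apply ih
      have := (Matrix.conjTranspose_mul_self_mul_eq_zero R (R ^ k * M)).1 (by
        rw [hH, ← h, pow_succ', pow_succ']; simp only [Matrix.mul_assoc])
      rw [pow_succ', Matrix.mul_assoc]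
      exact this

theorem Sig.rank {R : Matrix (Fin n) (Fin n) ℝ} {p q : ℕ} (h : Sig R p q) :
    R.rank = p + q := by
  have hle : p + q ≤ n := by
    obtain ⟨v, hv, -⟩ := h
    have := hv.fintype_card_le_finrank
    simpa using this
  obtain ⟨g, hg, rfl⟩ := h.to_sigCone
  have hg' : IsUnit g.det := (Matrix.isUnit_iff_isUnit_det g).1 hg
  rw [Matrix.rank_mul_eq_left_of_isUnit_det _ _ (by simpa using hg'),
    Matrix.rank_mul_eq_right_of_isUnit_det _ _ hg', signatureDiag, Matrix.rank_diagonal]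
  have : ∀ i : Fin n, ((if (i : ℕ) < p then (1 : ℝ) else if (i : ℕ) < p + q then -1 else 0) ≠ 0) ↔
      (i : ℕ) < p + q := by
    intro i
    split_ifs <;> simp <;> omega
  rw [Fintype.card_congr (Equiv.subtypeEquivRight this), Fintype.card_subtype]
  rw [Fin.card_filter_val_lt]
  omega

theorem projK_spec {R : Matrix (Fin n) (Fin n) ℝ} {p q k : ℕ} (h : Sig R p q)
    (hk : p + q + k = n) : R.charpoly.coeff k ≠ 0 ∧ R * projK k R = 0 ∧
      ∃ S, projK k R + R * S = 1 ∧ projK k R + S * R = 1 := by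
  have hH : R.IsHermitian := by
    rw [IsHermitian, conjTranspose_eq_transpose_of_trivial, h.symm]
  let Q : Polynomial ℝ := ∏ i with hH.eigenvalues i ≠ 0,
    (Polynomial.X - Polynomial.C (hH.eigenvalues i))
  have hcard : (Finset.univ.filter (fun i => hH.eigenvalues i ≠ 0)).card = p + q := by
    rw [← h.rank, hH.rank_eq_card_non_zero_eigs, Fintype.card_subtype]
  have hcard0 : (Finset.univ.filter (fun i => ¬ hH.eigenvalues i ≠ 0)).card = k := by
    have := Finset.card_filter_add_card_filter_not (s := (Finset.univ : Finset (Fin n)))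
      (fun i => hH.eigenvalues i ≠ 0)
    rw [hcard] at this
    simp only [Finset.card_univ, Fintype.card_fin] at this
    omega
  have hQ : R.charpoly = Polynomial.X ^ k * Q := by
    rw [hH.charpoly_eq, ← Finset.prod_filter_mul_prod_filter_not (s := Finset.univ)
      (fun i => hH.eigenvalues i ≠ 0), mul_comm]
    congr 1
    rw [← hcard0, Finset.prod_congr rfl (g := fun _ => Polynomial.X), Finset.prod_const]
    intro i hi
    simp only [ne_eq, not_not, Finset.mem_filter] at hi
    simp [hi.2]
  have hc : ∀ j, R.charpoly.coeff (j + k) = Q.coeff j := by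
    intro j; rw [hQ, Polynomial.coeff_X_pow_mul]
  have hc0 : R.charpoly.coeff k = Q.coeff 0 := by simpa using hc 0
  have hQ0 : Q.coeff 0 ≠ 0 := by
    rw [Polynomial.coeff_zero_eq_eval_zero, Polynomial.eval_prod, Finset.prod_ne_zero_iff]
    intro i hi
    simpa using hi
  have hdeg : Q.natDegree < n + 1 := by
    have := Polynomial.natDegree_prod_le (Finset.univ.filter (fun i => hH.eigenvalues i ≠ 0))
      (fun i => Polynomial.X - Polynomial.C (hH.eigenvalues i))
    simp only [Polynomial.natDegree_X_sub_C, Finset.sum_const, hcard, smul_eq_mul, mul_one] at this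
    exact lt_of_le_of_lt this (by omega)
  have hP : projK k R = (Q.coeff 0)⁻¹ • Polynomial.aeval R Q := by
    rw [projK, hc0, Polynomial.aeval_eq_sum_range' hdeg]
    simp only [hc]
  refine ⟨hc0 ▸ hQ0, ?_, -((Q.coeff 0)⁻¹ • Polynomial.aeval R Q.divX), ?_, ?_⟩
  · rw [hP, Matrix.mul_smul]
    rw [pow_ker h.symm k, smul_zero]
    have := Matrix.aeval_self_charpoly R
    rw [hQ] at this
    simpa using this
  · rw [hP]
    have : Polynomial.aeval R Q = R * Polynomial.aeval R Q.divX + Q.coeff 0 • 1 := by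
      have := congrArg (Polynomial.aeval R) (Polynomial.X_mul_divX_add Q).symm
      rwa [map_add, map_mul, Polynomial.aeval_X, Polynomial.aeval_C,
        Algebra.algebraMap_eq_smul_one] at this
    rw [this, smul_add, smul_smul, inv_mul_cancel₀ hQ0]
    simp
  · rw [hP]
    have : Polynomial.aeval R Q = Polynomial.aeval R Q.divX * R + Q.coeff 0 • 1 := by
      have := congrArg (Polynomial.aeval R) (Polynomial.divX_mul_X_add Q).symm
      rwa [map_add, map_mul, Polynomial.aeval_X, Polynomial.aeval_C,
        Algebra.algebraMap_eq_smul_one] at this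
    rw [this, smul_add, smul_smul, inv_mul_cancel₀ hQ0]
    simp

theorem projK_continuous {X : Type*} [TopologicalSpace X] {R : X → Matrix (Fin n) (Fin n) ℝ}
    {p q k : ℕ} (hR : Continuous R) (h : ∀ t, Sig (R t) p q) (hk : p + q + k = n) :
    Continuous (fun t => projK k (R t)) := by
  unfold projK
  have hc : ∀ j, Continuous (fun t => (R t).charpoly.coeff j) :=
    fun j => (continuous_charpoly_coeff j).comp hR
  refine Continuous.smul ((hc k).inv₀ fun t => (projK_spec (h t) hk).1) ?_
  refine continuous_finsetSum _ fun j _ => (hc _).smul (hR.pow j)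

theorem Sig.exists_pos {x : Matrix (Fin n) (Fin n) ℝ} {p q : ℕ} (h : Sig x (p + 1) q) :
    ∃ w, 0 < w ⬝ᵥ (x *ᵥ w) := by
  obtain ⟨v, hv, rfl⟩ := h
  let i0 : Fin (p + 1) ⊕ Fin q := Sum.inl 0
  by_contra! hcon
  have : v i0 ∈ Submodule.span ℝ (Set.range fun j : {j // j ≠ i0} => v j) := by
    refine mem_span_of_dot _ _ fun y hy => ?_
    have h1 := hcon y
    rw [frm_quad, Finset.sum_eq_single i0] at h1
    · have : (v i0 ⬝ᵥ y) ^ 2 ≤ 0 := by simpa [sgn, i0] using h1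
      exact pow_eq_zero_iff two_ne_zero |>.1 (le_antisymm this (sq_nonneg _))
    · intro j _ hj
      simp [hy ⟨j, hj⟩]
    · simp
  have h2 := linearIndependent_iff_notMem_span.1 hv i0
  apply h2
  have e : Set.image v (Set.univ \ {i0}) = Set.range (fun j : {j // j ≠ i0} => v j) := by
    ext z
    simp
  rw [e]
  exact this

theorem select_w {x : I → Matrix (Fin n) (Fin n) ℝ} (hx : Continuous x) (h01 : x 0 = x 1)
    {p q : ℕ} (h : ∀ t, Sig (x t) (p + 1) q) :
    ∃ (τ : I → I) (Y : I → Matrix (Fin n) (Fin n) ℝ), Continuous τ ∧ Continuous Y ∧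
      τ 0 = 0 ∧ τ 1 = 1 ∧ Y 0 = Y 1 ∧
      ∀ t, ∃ w, Y t = vecMulVec w w ∧ 0 < w ⬝ᵥ (x (τ t) *ᵥ w) := by
  let O : I → Set (Matrix (Fin n) (Fin n) ℝ) :=
    fun t => {Y | ∃ w, Y = vecMulVec w w ∧ 0 < w ⬝ᵥ (x t *ᵥ w)}
  obtain ⟨w0, hw0⟩ := (h 0).exists_pos
  have hm : vecMulVec w0 w0 ∈ O 0 := ⟨w0, rfl, hw0⟩
  have hm1 : vecMulVec w0 w0 ∈ O 1 := ⟨w0, rfl, h01 ▸ hw0⟩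
  have hpc : ∀ t, ∀ x ∈ O t, ∀ y ∈ O t, JoinedIn (O t) x y := by
    rintro t _ ⟨w, rfl, hw⟩ _ ⟨w', rfl, hw'⟩
    wlog hs : 0 ≤ w ⬝ᵥ (x t *ᵥ w') generalizing w'
    · have := this (-w') (by simpa [mulVec_neg] using hw') (by
        simp [mulVec_neg]; linarith)
      simpa [neg_vecMulVec, vecMulVec_neg] using this
    have hs' : w' ⬝ᵥ (x t *ᵥ w) = w ⬝ᵥ (x t *ᵥ w') := by
      rw [dotProduct_mulVec, ← mulVec_transpose, (h t).symm, dotProduct_comm]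
    refine JoinedIn.ofLine (f := fun s : ℝ => vecMulVec ((1 - s) • w + s • w') ((1 - s) • w + s • w'))
      ?_ (by simp) (by simp) ?_
    · refine Continuous.continuousOn ?_
      fun_prop
    · rintro _ ⟨s, ⟨h0, h1⟩, rfl⟩
      refine ⟨_, rfl, ?_⟩
      simp only [mulVec_add, mulVec_smul, dotProduct_add, add_dotProduct, smul_dotProduct,
        dotProduct_smul, smul_eq_mul, hs']
      have : 0 ≤ 1 - s := by linarith
      rcases h0.eq_or_lt with rfl | h0
      · simpa using hw
      · have := mul_pos h0 (mul_pos h0 hw')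
        have := mul_nonneg ‹0 ≤ 1 - s› (mul_nonneg ‹0 ≤ 1 - s› hw.le)
        have := mul_nonneg h0.le (mul_nonneg ‹0 ≤ 1 - s› hs)
        nlinarith
  have hloc : ∀ t, ∃ z, ∀ᶠ s in nhds t, z ∈ O s := by
    intro t
    obtain ⟨w, hw⟩ := (h t).exists_pos
    refine ⟨vecMulVec w w, ?_⟩
    have hc : Continuous (fun s => w ⬝ᵥ (x s *ᵥ w)) := by fun_prop
    filter_upwards [hc.continuousAt.eventually (lt_mem_nhds hw)] with s hs
    exact ⟨w, rfl, hs⟩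
  obtain ⟨τ, Y, a, b, c, d, e, f, g⟩ := aux_section O hpc hloc _ _ hm hm1
  exact ⟨τ, Y, a, b, c, d, e.trans f.symm, g⟩

theorem avoid3 (A B C : Submodule ℝ (Fin n → ℝ)) (hA : A ≠ ⊤) (hB : B ≠ ⊤) (hC : C ≠ ⊤) :
    ∃ z, z ∉ A ∧ z ∉ B ∧ z ∉ C := by
  classical
  have := Subspace.biUnion_ne_univ_of_top_notMem (s := {A, B, C}) (by
    simp [hA.symm, hB.symm, hC.symm])
  rw [Set.ne_univ_iff_exists_notMem] at this
  obtain ⟨z, hz⟩ := this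
  simp at hz
  exact ⟨z, by tauto⟩

theorem select_u {m : ℕ} {R : I → Matrix (Fin (m + 1)) (Fin (m + 1)) ℝ} (hR : Continuous R)
    (h01 : R 0 = R 1) {p q k : ℕ} (h : ∀ t, Sig (R t) p q) (hk : p + q + (k + 2) = m + 1) :
    ∃ (τ : I → I) (u : I → Fin (m + 1) → ℝ), Continuous τ ∧ Continuous u ∧
      τ 0 = 0 ∧ τ 1 = 1 ∧ u 0 = u 1 ∧ (∀ t, u t (Fin.last m) = 1) ∧
      ∀ t, projK (k + 2) (R (τ t)) *ᵥ u t ≠ 0 := by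
  let P : I → Matrix (Fin (m + 1)) (Fin (m + 1)) ℝ := fun t => projK (k + 2) (R t)
  have hP : Continuous P := projK_continuous hR h hk
  let O : I → Set (Fin (m + 1) → ℝ) := fun t => {u | u (Fin.last m) = 1 ∧ P t *ᵥ u ≠ 0}
  -- generic vectors
  have gen : ∀ t, ∀ u u' : Fin (m + 1) → ℝ, ∃ c : Fin (m + 1) → ℝ, c (Fin.last m) = 1 ∧
      (∀ a b : ℝ, b ≠ 0 → P t *ᵥ (a • u + b • c) ≠ 0) ∧
      (∀ a b : ℝ, b ≠ 0 → P t *ᵥ (a • u' + b • c) ≠ 0) := by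
    intro t u u'
    obtain ⟨-, -, S, hS, -⟩ := projK_spec (h t) hk
    have hker : ∀ z, P t *ᵥ z = 0 → z ∈ LinearMap.range (R t).mulVecLin := by
      intro z hz
      refine ⟨S *ᵥ z, ?_⟩
      have := congrArg (fun M => M *ᵥ z) hS
      simp only [add_mulVec, one_mulVec] at this
      simp only [P] at hz
      rw [hz, zero_add] at this
      simpa using this
    let W : (Fin (m + 1) → ℝ) → Submodule ℝ (Fin (m + 1) → ℝ) :=
      fun u => LinearMap.range (R t).mulVecLin ⊔ Submodule.span ℝ {u}
    have hW : ∀ u, W u ≠ ⊤ := by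
      intro u hu
      have h1 := Submodule.finrank_add_le_finrank_add_finrank
        (LinearMap.range (R t).mulVecLin) (Submodule.span ℝ {u})
      have h2 : Module.finrank ℝ (LinearMap.range (R t).mulVecLin) = p + q := (h t).rank
      have h3 : Module.finrank ℝ (Submodule.span ℝ {u}) ≤ 1 :=
        (finrank_span_le_card ({u} : Set (Fin (m + 1) → ℝ))).trans (by simp)
      have h4 : Module.finrank ℝ (W u) = m + 1 := by rw [hu]; simp
      simp only [W] at h4
      omega
    have hL : LinearMap.ker (LinearMap.proj (R := ℝ) (φ := fun _ : Fin (m + 1) => ℝ) (Fin.last m)) ≠ ⊤ := by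
      intro hL
      have : (fun _ => 1 : Fin (m + 1) → ℝ) ∈ LinearMap.ker (LinearMap.proj (R := ℝ)
        (φ := fun _ : Fin (m + 1) => ℝ) (Fin.last m)) := by rw [hL]; trivial
      simp at this
    obtain ⟨c, hc1, hc2, hc3⟩ := avoid3 _ _ _ (hW u) (hW u') hL
    have hc0 : c (Fin.last m) ≠ 0 := by simpa using hc3
    have main : ∀ u, c ∉ W u → ∀ a b : ℝ, b ≠ 0 →
        P t *ᵥ (a • u + b • ((c (Fin.last m))⁻¹ • c)) ≠ 0 := by
      intro u hu a b hb hz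
      apply hu
      have h1 := hker _ hz
      have h2 : a • u ∈ W u :=
        Submodule.mem_sup_right (Submodule.smul_mem _ _ (Submodule.mem_span_singleton_self u))
      have h3 : (b * (c (Fin.last m))⁻¹) • c ∈ W u := by
        have := Submodule.sub_mem _ (Submodule.mem_sup_left h1 : _ ∈ W u) h2
        rwa [add_sub_cancel_left, smul_smul] at this
      rwa [Submodule.smul_mem_iff _ (mul_ne_zero hb (inv_ne_zero hc0))] at h3
    exact ⟨(c (Fin.last m))⁻¹ • c, by simp [hc0], main u hc1, main u' hc2⟩
  obtain ⟨c0, hc0, hc0', -⟩ := gen 0 0 0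
  have hm : c0 ∈ O 0 := ⟨hc0, by simpa using hc0' 0 1 one_ne_zero⟩
  have hm1 : c0 ∈ O 1 := by simpa [O, P, h01] using hm
  have hpc : ∀ t, ∀ x ∈ O t, ∀ y ∈ O t, JoinedIn (O t) x y := by
    rintro t u ⟨hu1, hu2⟩ u' ⟨hu1', hu2'⟩
    obtain ⟨c, hc1, hc2, hc3⟩ := gen t u u'
    have main : ∀ u : Fin (m + 1) → ℝ, u (Fin.last m) = 1 → P t *ᵥ u ≠ 0 →
        (∀ a b : ℝ, b ≠ 0 → P t *ᵥ (a • u + b • c) ≠ 0) → JoinedIn (O t) u c := by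
      intro u hu1 hu2 hc
      refine JoinedIn.ofLine (f := fun s : ℝ => (1 - s) • u + s • c) ?_ (by simp) (by simp) ?_
      · refine Continuous.continuousOn ?_
        fun_prop
      · rintro _ ⟨s, ⟨h0, h1⟩, rfl⟩
        refine ⟨by simp [hu1, hc1], ?_⟩
        by_cases hs : s = 0
        · simpa [hs] using hu2
        · exact hc _ _ hs
    exact (main u hu1 hu2 hc2).trans (main u' hu1' hu2' hc3).symm
  have hloc : ∀ t, ∃ z, ∀ᶠ s in nhds t, z ∈ O s := by
    intro t
    obtain ⟨c, hc1, hc2, -⟩ := gen t 0 0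
    have hc3 : P t *ᵥ c ≠ 0 := by simpa using hc2 0 1 one_ne_zero
    have hcont : Continuous (fun s => P s *ᵥ c) := by fun_prop
    refine ⟨c, ?_⟩
    filter_upwards [hcont.continuousAt.eventually_ne hc3] with s hs
    exact ⟨hc1, hs⟩
  obtain ⟨τ, Y, a, b, c, d, e, f, g⟩ := aux_section O hpc hloc _ _ hm hm1
  exact ⟨τ, Y, a, b, c, d, e.trans f.symm, fun t => (g t).1, fun t => (g t).2⟩

end Proj


section Main
variable {n : ℕ}

/-- The union of the three cones. -/
def UU (n p q : ℕ) : Set (Matrix (Fin n) (Fin n) ℝ) :=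
  sigCone n (p + 1) q ∪ sigCone n p q ∪ sigCone n p (q + 1)

theorem Sig.mem_UU {x : Matrix (Fin n) (Fin n) ℝ} {p q : ℕ} (h : Sig x p q) : x ∈ UU n p q :=
  Or.inl (Or.inr h.to_sigCone)

theorem Sig.mem_UU' {x : Matrix (Fin n) (Fin n) ℝ} {p q : ℕ} (h : Sig x (p + 1) q) :
    x ∈ UU n p q :=
  Or.inl (Or.inl h.to_sigCone)

theorem UU_cases {x : Matrix (Fin n) (Fin n) ℝ} {p q : ℕ} (hpq : p + q < n) (h : x ∈ UU n p q) :
    Sig x (p + 1) q ∨ Sig x p q ∨ Sig x p (q + 1) := by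
  rcases h with (h | h) | h
  · exact Or.inl (Sig.of_sigCone (by omega) h)
  · exact Or.inr (Or.inl (Sig.of_sigCone (by omega) h))
  · exact Or.inr (Or.inr (Sig.of_sigCone (by omega) h))

theorem vmv_smul (a : ℝ) (z : Fin n → ℝ) :
    vecMulVec (a • z) (a • z) = (a ^ 2) • vecMulVec z z := by
  rw [smul_vecMulVec, vecMulVec_smul, smul_smul, sq]

theorem vmv_sqrt {a : ℝ} (ha : 0 ≤ a) (z : Fin n → ℝ) :
    a • vecMulVec z z = vecMulVec (√a • z) (√a • z) := by
  rw [vmv_smul, Real.sq_sqrt ha]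

theorem dot_self_pos {z : Fin n → ℝ} (hz : z ≠ 0) : 0 < z ⬝ᵥ z := by
  have h1 : 0 ≤ z ⬝ᵥ z := by
    rw [dotProduct]; exact Finset.sum_nonneg fun i _ => mul_self_nonneg _
  exact lt_of_le_of_ne h1 fun h => hz (dotProduct_self_eq_zero.1 h.symm)

theorem Sig.add_smul {R : Matrix (Fin n) (Fin n) ℝ} {p q : ℕ} (h : Sig R p q) (y z : Fin n → ℝ)
    (hy : R *ᵥ y = 0) (hz : z ⬝ᵥ y ≠ 0) {a : ℝ} (ha : 0 < a) :
    Sig (R + a • vecMulVec z z) (p + 1) q := by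
  rw [vmv_sqrt ha.le]
  refine h.add y _ hy ?_
  rw [smul_dotProduct, smul_eq_mul]
  exact mul_ne_zero (Real.sqrt_ne_zero'.2 ha) hz

theorem conj_vmv {m : ℕ} (B : Matrix (Fin m) (Fin n) ℝ) (w : Fin n → ℝ) :
    B * vecMulVec w w * Bᵀ = vecMulVec (B *ᵥ w) (B *ᵥ w) := by
  rw [mul_vecMulVec, vecMulVec_mul, vecMul_transpose]

theorem Sig.red {x : Matrix (Fin n) (Fin n) ℝ} {p q : ℕ} (h : Sig x (p + 1) q) (w : Fin n → ℝ)
    (hw : 0 < w ⬝ᵥ (x *ᵥ w)) :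
    Sig (x - (w ⬝ᵥ (x *ᵥ w))⁻¹ • (x * vecMulVec w w * xᵀ)) p q ∧
      (x - (w ⬝ᵥ (x *ᵥ w))⁻¹ • (x * vecMulVec w w * xᵀ)) *ᵥ w = 0 := by
  set c := w ⬝ᵥ (x *ᵥ w) with hc
  rw [conj_vmv]
  set R := x - c⁻¹ • vecMulVec (x *ᵥ w) (x *ᵥ w) with hR
  have hRw : R *ᵥ w = 0 := by
    rw [hR, sub_mulVec, smul_mulVec, vecMulVec_mulVec, dotProduct_comm, ← hc]
    ext i
    simp [hw.ne']
  have hRs : Rᵀ = R := by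
    rw [hR, transpose_sub, transpose_smul, transpose_vecMulVec, h.symm]
  obtain ⟨p', q', h'⟩ := Sig.exists hRs
  have h2 := h'.add_smul w (x *ᵥ w) hRw (by rw [dotProduct_comm]; exact hw.ne') (inv_pos.2 hw)
  rw [hR, sub_add_cancel] at h2
  have := h.unique h2
  obtain ⟨h3, rfl⟩ := this
  obtain rfl : p = p' := by omega
  exact ⟨h', hRw⟩

theorem Sig.two {R : Matrix (Fin n) (Fin n) ℝ} {p q : ℕ} (h : Sig R p q) (w z : Fin n → ℝ)
    (hw : R *ᵥ w = 0) (hz : R *ᵥ z = 0) (hw0 : w ≠ 0) (hz0 : z ≠ 0) {a b : ℝ} (ha : 0 ≤ a)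
    (hb : 0 ≤ b) (hab : 0 < a + b) :
    R + a • vecMulVec w w + b • vecMulVec z z ∈ UU n (p + 1) q := by
  have hww := dot_self_pos hw0
  have hzz := dot_self_pos hz0
  rcases ha.eq_or_lt with rfl | ha'
  · refine Sig.mem_UU ?_
    simpa using h.add_smul z z hz hzz.ne' (by linarith)
  rcases hb.eq_or_lt with rfl | hb'
  · refine Sig.mem_UU ?_
    simpa using h.add_smul w w hw hww.ne' ha'
  set y := z - ((w ⬝ᵥ z) / (w ⬝ᵥ w)) • w with hy
  have hwy : w ⬝ᵥ y = 0 := by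
    rw [hy, dotProduct_sub, dotProduct_smul, smul_eq_mul]
    field_simp
    simp
  have hRy : R *ᵥ y = 0 := by
    rw [hy, mulVec_sub, mulVec_smul, hw, hz]; simp
  by_cases hy0 : y = 0
  · have hz' : z = ((w ⬝ᵥ z) / (w ⬝ᵥ w)) • w := by rwa [hy, sub_eq_zero] at hy0
    refine Sig.mem_UU ?_
    rw [hz', vmv_smul, smul_smul, add_assoc, ← _root_.add_smul]
    exact h.add_smul w w hw hww.ne' (add_pos_of_pos_of_nonneg ha' (by positivity))
  · refine Sig.mem_UU' ?_
    refine (h.add_smul w w hw hww.ne' ha').add_smul y z ?_ ?_ hb'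
    · rw [add_mulVec, smul_mulVec, vecMulVec_mulVec, hRy, hwy]; simp
    · have : z = y + ((w ⬝ᵥ z) / (w ⬝ᵥ w)) • w := by rw [hy]; simp
      rw [this, add_dotProduct, smul_dotProduct, hwy]
      simpa using (dot_self_pos hy0).ne'

theorem stepA {x : I → Matrix (Fin n) (Fin n) ℝ} (hx : Continuous x) (h01 : x 0 = x 1)
    {p q : ℕ} (h : ∀ t, Sig (x t) (p + 1) q) :
    ∃ R Y : I → Matrix (Fin n) (Fin n) ℝ, Continuous R ∧ Continuous Y ∧ R 0 = R 1 ∧ Y 0 = Y 1 ∧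
      (∀ t, Sig (R t) p q) ∧ (∀ t, ∃ w, w ≠ 0 ∧ Y t = vecMulVec w w ∧ R t *ᵥ w = 0) ∧
      FH (UU n (p + 1) q) x (fun t => R t + Y t) := by
  obtain ⟨τ, Y, hτ, hY, t0, t1, hY01, hw⟩ := select_w hx h01 h
  have hre : FH (UU n (p + 1) q) x (fun t => x (τ t)) :=
    FH.reparam hx (fun t => (h t).mem_UU) h01 τ hτ t0 t1
  let c : I → ℝ := fun t => trace (x (τ t) * Y t)
  have hxt : Continuous fun t => x (τ t) := hx.comp hτ
  have hc : Continuous c := by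
    apply Continuous.matrix_trace
    exact hxt.matrix_mul hY
  have hx01 : x (τ 0) = x (τ 1) := by rw [t0, t1, h01]
  have hc01 : c 0 = c 1 := by simp only [c]; rw [hx01, hY01]
  have hcw : ∀ t w, Y t = vecMulVec w w → c t = w ⬝ᵥ (x (τ t) *ᵥ w) := by
    intro t w hw
    simp only [c]
    rw [hw, mul_vecMulVec, trace_vecMulVec, dotProduct_comm]
  have hcpos : ∀ t, 0 < c t := by
    intro t
    obtain ⟨w, e, hw⟩ := hw t
    rwa [hcw t w e]
  have hci : Continuous fun t => (c t)⁻¹ := hc.inv₀ fun t => (hcpos t).ne'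
  let R : I → Matrix (Fin n) (Fin n) ℝ :=
    fun t => x (τ t) - (c t)⁻¹ • (x (τ t) * Y t * (x (τ t))ᵀ)
  have hR : Continuous R :=
    hxt.sub (hci.smul ((hxt.matrix_mul hY).matrix_mul hxt.matrix_transpose))
  have hR01 : R 0 = R 1 := by simp only [R]; rw [hx01, hY01, hc01]
  have hred : ∀ t w, Y t = vecMulVec w w → Sig (R t) p q ∧ R t *ᵥ w = 0 := by
    intro t w e
    have := (h (τ t)).red w (by rw [← hcw t w e]; exact hcpos t)
    rwa [← hcw t w e, ← e] at this
  have hRS : ∀ t, Sig (R t) p q := by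
    intro t
    obtain ⟨w, e, -⟩ := hw t
    exact (hred t w e).1
  have hw0 : ∀ t w, 0 < w ⬝ᵥ (x (τ t) *ᵥ w) → w ≠ 0 := by
    rintro t w hw rfl
    simp at hw
  refine ⟨R, fun t => (c t)⁻¹ • Y t, hR, hci.smul hY, hR01, by simp only []; rw [hc01, hY01], hRS, ?_,
    hre.trans ?_⟩
  · intro t
    obtain ⟨w, e, hwp⟩ := hw t
    refine ⟨√((c t)⁻¹) • w, ?_, ?_, ?_⟩
    · exact smul_ne_zero (Real.sqrt_ne_zero'.2 (inv_pos.2 (hcpos t))) (hw0 t w hwp)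
    · beta_reduce
      rw [e, vmv_sqrt (inv_pos.2 (hcpos t)).le]
    · rw [mulVec_smul, (hred t w e).2, smul_zero]
  · refine FH.mk (fun s t => R t + (c t)⁻¹ • (((1 - s) • x (τ t) + s • 1) * Y t *
      ((1 - s) • x (τ t) + s • 1)ᵀ)) ?_ ?_ ?_ ?_ ?_
    · have hB : Continuous fun z : I × I => (1 - (z.1 : ℝ)) • x (τ z.2) +
          (z.1 : ℝ) • (1 : Matrix (Fin n) (Fin n) ℝ) := by
        have := hxt.comp (continuous_snd (X := I) (Y := I))
        simp only [Function.comp_def] at this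
        fun_prop
      have hY' := hY.comp (continuous_snd (X := I) (Y := I))
      exact (hR.comp continuous_snd).add ((hci.comp continuous_snd).smul
        ((hB.matrix_mul hY').matrix_mul hB.matrix_transpose))
    · intro s h0 h1 t
      obtain ⟨w, e, hwp⟩ := hw t
      refine Sig.mem_UU ?_
      rw [e, conj_vmv]
      refine (hRS t).add_smul w _ (hred t w e).2 ?_ (inv_pos.2 (hcpos t))
      rw [add_mulVec, smul_mulVec, smul_mulVec, one_mulVec, add_dotProduct, smul_dotProduct,
        smul_dotProduct, dotProduct_comm _ w]
      have h2 := dot_self_pos (hw0 t w hwp)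
      simp only [smul_eq_mul]
      rcases h0.eq_or_lt with rfl | h0
      · simpa using hwp.ne'
      · have := mul_pos h0 h2
        have := mul_nonneg (sub_nonneg.2 h1) hwp.le
        linarith
    · intro s
      rw [hR01, hc01, hx01, hY01]
    · intro t; simp [R]
    · intro t; simp

theorem stepB {m : ℕ} {R Y : I → Matrix (Fin (m + 1)) (Fin (m + 1)) ℝ} (hR : Continuous R)
    (hY : Continuous Y) (hR01 : R 0 = R 1) (hY01 : Y 0 = Y 1) {p q : ℕ} (hpq : p + q < m)
    (h : ∀ t, Sig (R t) p q) (hw : ∀ t, ∃ w, w ≠ 0 ∧ Y t = vecMulVec w w ∧ R t *ᵥ w = 0) :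
    ∃ (R' : I → Matrix (Fin (m + 1)) (Fin (m + 1)) ℝ) (u : I → Fin (m + 1) → ℝ),
      Continuous R' ∧ Continuous u ∧ R' 0 = R' 1 ∧ u 0 = u 1 ∧ (∀ t, Sig (R' t) p q) ∧
      (∀ t, u t (Fin.last m) = 1) ∧ (∀ t, ∃ z, R' t *ᵥ z = 0 ∧ u t ⬝ᵥ z ≠ 0) ∧
      FH (UU (m + 1) (p + 1) q) (fun t => R t + Y t)
        (fun t => R' t + vecMulVec (u t) (u t)) := by
  obtain ⟨k, hk⟩ : ∃ k, p + q + (k + 2) = m + 1 := ⟨m - 1 - p - q, by omega⟩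
  obtain ⟨τ, u, hτ, hu, t0, t1, hu01, hu1, hz⟩ := select_u hR hR01 h hk
  have hS : ∀ t, R t + Y t ∈ UU (m + 1) (p + 1) q := by
    intro t
    obtain ⟨w, hw0, e, hRw⟩ := hw t
    rw [e]
    exact ((h t).add w w hRw (dot_self_pos hw0).ne').mem_UU
  have hre := FH.reparam (f := fun t => R t + Y t) (hR.add hY) hS (by rw [hR01, hY01]) τ hτ t0 t1
  have hR' : Continuous fun t => R (τ t) := hR.comp hτ
  have hY' : Continuous fun t => Y (τ t) := hY.comp hτ
  have hR'01 : R (τ 0) = R (τ 1) := by rw [t0, t1, hR01]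
  have hY'01 : Y (τ 0) = Y (τ 1) := by rw [t0, t1, hY01]
  let z : I → Fin (m + 1) → ℝ := fun t => projK (k + 2) (R (τ t)) *ᵥ u t
  have hzc : Continuous z :=
    (projK_continuous hR' (fun t => h (τ t)) hk).matrix_mulVec hu
  have hz01 : z 0 = z 1 := by simp only [z]; rw [hR'01, hu01]
  have hRz : ∀ t, R (τ t) *ᵥ z t = 0 := by
    intro t
    simp only [z]
    rw [mulVec_mulVec, (projK_spec (h (τ t)) hk).2.1, zero_mulVec]
  have huz : ∀ t, u t ⬝ᵥ z t = z t ⬝ᵥ z t := by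
    intro t
    obtain ⟨-, -, S, hS, -⟩ := projK_spec (h (τ t)) hk
    have h1 := congrArg (fun M => M *ᵥ u t) hS
    simp only [add_mulVec, one_mulVec] at h1
    have h2 : u t = z t + R (τ t) *ᵥ (S *ᵥ u t) := by rw [mulVec_mulVec]; exact h1.symm
    have h3 : (R (τ t) *ᵥ (S *ᵥ u t)) ⬝ᵥ z t = 0 := by
      rw [dotProduct_comm, dotProduct_mulVec, ← mulVec_transpose, (h (τ t)).symm, hRz,
        zero_dotProduct]
    conv_lhs => rw [h2]
    rw [add_dotProduct, h3, add_zero]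
  have hzz : ∀ t, 0 < z t ⬝ᵥ z t := fun t => dot_self_pos (hz t)
  refine ⟨fun t => R (τ t), u, hR', hu, hR'01, hu01, fun t => h (τ t), hu1,
    fun t => ⟨z t, hRz t, by rw [huz]; exact (hzz t).ne'⟩, hre.trans (FH.trans (g := fun t => R (τ t) + vecMulVec (z t) (z t)) ?_ ?_)⟩
  · refine FH.mk (fun s t => R (τ t) + (1 - s) • Y (τ t) + s • vecMulVec (z t) (z t))
      ?_ ?_ ?_ ?_ ?_
    · have a1 := hR'.comp (continuous_snd (X := I) (Y := I))
      have a2 := hY'.comp (continuous_snd (X := I) (Y := I))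
      have a3 := hzc.comp (continuous_snd (X := I) (Y := I))
      simp only [Function.comp_def] at a1 a2 a3
      exact (a1.add (Continuous.smul (continuous_const.sub (continuous_subtype_val.comp continuous_fst)) a2)).add
        (Continuous.smul (continuous_subtype_val.comp continuous_fst) (a3.matrix_vecMulVec a3))
    · intro s h0 h1 t
      obtain ⟨w, hw0, e, hRw⟩ := hw (τ t)
      rw [e]
      exact (h (τ t)).two w (z t) hRw (hRz t) hw0 (hz t) (by linarith) h0 (by linarith)
    · intro s
      rw [hR'01, hY'01, hz01]
    · intro t; simp
    · intro t; simp
  · refine FH.mk (fun s t => R (τ t) + vecMulVec (z t + s • (u t - z t)) (z t + s • (u t - z t)))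
      ?_ ?_ ?_ ?_ ?_
    · have a1 := hR'.comp (continuous_snd (X := I) (Y := I))
      have a2 := hu.comp (continuous_snd (X := I) (Y := I))
      have a3 := hzc.comp (continuous_snd (X := I) (Y := I))
      simp only [Function.comp_def] at a1 a2 a3
      have a4 : Continuous fun x : I × I => z x.2 + (x.1 : ℝ) • (u x.2 - z x.2) := by
        fun_prop
      exact a1.add (a4.matrix_vecMulVec a4)
    · intro s h0 h1 t
      refine ((h (τ t)).add (z t) _ (hRz t) ?_).mem_UU
      rw [add_dotProduct, smul_dotProduct, sub_dotProduct, huz]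
      simpa using hz t
    · intro s
      rw [hR'01, hu01, hz01]
    · intro t; simp
    · intro t; simp

/-- The last basis vector. -/
def eL (m : ℕ) : Fin (m + 1) → ℝ := Pi.single (Fin.last m) 1

/-- The inclusion of the first coordinates. -/
def JJ (m : ℕ) : Matrix (Fin (m + 1)) (Fin m) ℝ :=
  Matrix.of fun i j => if i = j.castSucc then 1 else 0

theorem JJ_inj (m : ℕ) (x : Fin m → ℝ) (h : JJ m *ᵥ x = 0) : x = 0 := by
  ext i
  have := congrFun h i.castSucc
  simpa [JJ, mulVec, dotProduct] using this

theorem JJ_e (m : ℕ) : (JJ m)ᵀ *ᵥ eL m = 0 := by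
  ext i
  simp [JJ, eL, Matrix.mulVec, (Fin.castSucc_lt_last i).ne']

theorem JJ_fac {m : ℕ} (B : Matrix (Fin (m + 1)) (Fin (m + 1)) ℝ)
    (hB : ∀ j, B (Fin.last m) j = 0) : JJ m * B.submatrix Fin.castSucc id = B := by
  ext i j
  refine Fin.lastCases ?_ (fun i => ?_) i
  · rw [hB, mul_apply]
    refine Finset.sum_eq_zero fun k _ => ?_
    simp [JJ, (Fin.castSucc_lt_last k).ne']
  · simp [JJ, mul_apply]

theorem stepC {m : ℕ} {R : I → Matrix (Fin (m + 1)) (Fin (m + 1)) ℝ} {u : I → Fin (m + 1) → ℝ}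
    (hR : Continuous R)
    (hu : Continuous u) (hR01 : R 0 = R 1) (hu01 : u 0 = u 1) {p q : ℕ} (hpq : p + q < m)
    (h : ∀ t, Sig (R t) p q) (hu1 : ∀ t, u t (Fin.last m) = 1)
    (hz : ∀ t, ∃ z, R t *ᵥ z = 0 ∧ u t ⬝ᵥ z ≠ 0)
    (IH : ∀ A : I → Matrix (Fin m) (Fin m) ℝ, Continuous A → A 0 = A 1 → (∀ t, Sig (A t) p q) →
      ∃ c, FH (UU m p q) A (fun _ => c)) :
    ∃ c, FH (UU (m + 1) (p + 1) q) (fun t => R t + vecMulVec (u t) (u t)) (fun _ => c) := by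
  let e := eL m
  have heu : ∀ t, e ⬝ᵥ u t = 1 := by intro t; simp [e, eL, hu1]
  have hee : e ⬝ᵥ e = 1 := by simp [e, eL]
  let B : ℝ → I → Matrix (Fin (m + 1)) (Fin (m + 1)) ℝ := fun s t => 1 - s • vecMulVec (u t) e
  have hBx : ∀ s t x, B s t *ᵥ x = x - (s * (e ⬝ᵥ x)) • u t := by
    intro s t x
    simp only [B]
    rw [sub_mulVec, one_mulVec, smul_mulVec, vecMulVec_mulVec]
    ext i
    simp
    ring
  have hBTx : ∀ s t x, (B s t)ᵀ *ᵥ x = x - (s * (u t ⬝ᵥ x)) • e := by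
    intro s t x
    simp only [B]
    rw [transpose_sub, transpose_one, transpose_smul, transpose_vecMulVec, sub_mulVec, one_mulVec,
      smul_mulVec, vecMulVec_mulVec]
    ext i
    simp
    ring
  have hBk : ∀ s t x, B s t *ᵥ x = 0 → ∃ c : ℝ, x = c • u t := by
    intro s t x hx
    rw [hBx, sub_eq_zero] at hx
    exact ⟨_, hx⟩
  have hBc : Continuous fun z : I × I => B z.1 z.2 := by
    have a1 := hu.comp (continuous_snd (X := I) (Y := I))
    simp only [Function.comp_def] at a1
    exact continuous_const.sub (Continuous.smul (continuous_subtype_val.comp continuous_fst) (a1.matrix_vecMulVec continuous_const))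
  have hB1c : Continuous (B 1) :=
    continuous_const.sub ((hu.matrix_vecMulVec continuous_const).const_smul (1 : ℝ))
  have hB01 : ∀ s, B s 0 = B s 1 := by intro s; simp only [B]; rw [hu01]
  have hconj : ∀ s t, Sig (B s t * R t * (B s t)ᵀ) p q := by
    intro s t
    obtain ⟨z, hz1, hz2⟩ := hz t
    exact (h t).conj _ (u t) z (hBk s t) hz1 hz2
  -- phase 4
  have P4 : FH (UU (m + 1) (p + 1) q) (fun t => R t + vecMulVec (u t) (u t))
      (fun t => B 1 t * R t * (B 1 t)ᵀ + vecMulVec (u t) (u t)) := by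
    refine FH.mk (fun s t => B s t * R t * (B s t)ᵀ + vecMulVec (u t) (u t)) ?_ ?_ ?_ ?_ ?_
    · have a1 := hu.comp (continuous_snd (X := I) (Y := I))
      have a2 := hR.comp (continuous_snd (X := I) (Y := I))
      simp only [Function.comp_def] at a1 a2
      exact ((hBc.matrix_mul a2).matrix_mul hBc.matrix_transpose).add (a1.matrix_vecMulVec a1)
    · intro s h0 h1 t
      obtain ⟨z, hz1, hz2⟩ := hz t
      refine ((hconj s t).add ((1 - s) • z + (s * (u t ⬝ᵥ z)) • e) _ ?_ ?_).mem_UU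
      · have : (B s t)ᵀ *ᵥ ((1 - s) • z + (s * (u t ⬝ᵥ z)) • e) = (1 - s) • z := by
          rw [hBTx]
          simp only [dotProduct_add, dotProduct_smul, dotProduct_comm (u t) e, heu, smul_eq_mul]
          ext i
          simp
          ring
        rw [← mulVec_mulVec, this, ← mulVec_mulVec, mulVec_smul, hz1]
        simp
      · simp only [dotProduct_add, dotProduct_smul, dotProduct_comm (u t) e, heu, smul_eq_mul]
        convert hz2 using 1
        ring
    · intro s
      rw [hB01, hR01, hu01]
    · intro t; simp [B]
    · intro t; rfl
  -- phase 5
  have hB1e : ∀ t, (B 1 t)ᵀ *ᵥ e = 0 := by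
    intro t
    rw [hBTx, dotProduct_comm, heu]
    simp
  have P5 : FH (UU (m + 1) (p + 1) q) (fun t => B 1 t * R t * (B 1 t)ᵀ + vecMulVec (u t) (u t))
      (fun t => B 1 t * R t * (B 1 t)ᵀ + vecMulVec e e) := by
    refine FH.mk (fun s t => B 1 t * R t * (B 1 t)ᵀ +
      vecMulVec ((1 - s) • u t + s • e) ((1 - s) • u t + s • e)) ?_ ?_ ?_ ?_ ?_
    · have a1 := hu.comp (continuous_snd (X := I) (Y := I))
      have a2 := hR.comp (continuous_snd (X := I) (Y := I))
      have a3 := hB1c.comp (continuous_snd (X := I) (Y := I))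
      simp only [Function.comp_def] at a1 a2 a3
      have a4 : Continuous fun x : I × I => (1 - (x.1 : ℝ)) • u x.2 + (x.1 : ℝ) • e := by
        fun_prop
      exact ((a3.matrix_mul a2).matrix_mul a3.matrix_transpose).add (a4.matrix_vecMulVec a4)
    · intro s h0 h1 t
      refine ((hconj 1 t).add e _ ?_ ?_).mem_UU
      · rw [← mulVec_mulVec, hB1e, mulVec_zero]
      · simp only [add_dotProduct, smul_dotProduct, dotProduct_comm (u t) e, heu, hee, smul_eq_mul]
        ring_nf
        simp
    · intro s
      rw [hB01, hR01, hu01]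
    · intro t; simp
    · intro t; simp
  -- phase 6
  have hB1last : ∀ t j, B 1 t (Fin.last m) j = 0 := by
    intro t j
    have := congrFun (hB1e t) j
    simpa [e, eL] using this
  let K : I → Matrix (Fin m) (Fin (m + 1)) ℝ := fun t => (B 1 t).submatrix Fin.castSucc id
  have hK : ∀ t, JJ m * K t = B 1 t := fun t => JJ_fac _ (hB1last t)
  have hKc : Continuous K := hB1c.matrix_submatrix _ _
  obtain ⟨c, hc⟩ := IH (fun t => K t * R t * (K t)ᵀ)
    ((hKc.matrix_mul hR).matrix_mul hKc.matrix_transpose)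
    (by simp only [K]; rw [hB01, hR01]) (by
      intro t
      obtain ⟨z, hz1, hz2⟩ := hz t
      refine (h t).conj _ (u t) z (fun x hx => hBk 1 t x ?_) hz1 hz2
      rw [← hK, ← mulVec_mulVec, hx, mulVec_zero])
  have key : ∀ (A : Matrix (Fin m) (Fin m) ℝ) (a b : ℕ), Sig A a b → Sig (JJ m * A * (JJ m)ᵀ + vecMulVec e e) (a + 1) b := by
    intro A a b hA
    refine (hA.conj_inj (JJ m) (JJ_inj m)).add e e ?_ (by rw [hee]; exact one_ne_zero)
    rw [← mulVec_mulVec, JJ_e, mulVec_zero]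
  have P6 := FH.map (V := UU (m + 1) (p + 1) q) (fun A : Matrix (Fin m) (Fin m) ℝ => JJ m * A * (JJ m)ᵀ + vecMulVec e e)
    (by fun_prop) (by
      intro A hA
      rcases UU_cases hpq hA with hA | hA | hA
      · exact (key _ _ _ hA).mem_UU'
      · exact (key _ _ _ hA).mem_UU
      · exact Or.inr (key _ _ _ hA).to_sigCone) hc
  refine ⟨JJ m * c * (JJ m)ᵀ + vecMulVec e e, P4.trans (P5.trans ?_)⟩
  convert P6 using 3 with t
  rw [← hK, transpose_mul]
  simp only [Matrix.mul_assoc]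

theorem main_ind (n : ℕ) : ∀ p q, p + q < n → ∀ A : I → Matrix (Fin n) (Fin n) ℝ, Continuous A →
    A 0 = A 1 → (∀ t, Sig (A t) p q) → ∃ c, FH (UU n p q) A (fun _ => c) := by
  induction n with
  | zero => intro p q h; omega
  | succ m ih =>
    have step : ∀ p q, (p + 1) + q < m + 1 → ∀ A : I → Matrix (Fin (m + 1)) (Fin (m + 1)) ℝ,
        Continuous A → A 0 = A 1 → (∀ t, Sig (A t) (p + 1) q) →
        ∃ c, FH (UU (m + 1) (p + 1) q) A (fun _ => c) := by
      intro p q hpq A hA h01 h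
      obtain ⟨R, Y, hR, hY, hR01, hY01, hS, hw, F1⟩ := stepA hA h01 h
      obtain ⟨R', u, hR', hu, hR'01, hu01, hS', hu1, hz, F2⟩ :=
        stepB hR hY hR01 hY01 (by omega) hS hw
      obtain ⟨c, F3⟩ := stepC hR' hu hR'01 hu01 (by omega) hS' hu1 hz (ih p q (by omega))
      exact ⟨c, F1.trans (F2.trans F3)⟩
    intro p q hpq A hA h01 h
    cases p with
    | succ p => exact step p q hpq A hA h01 h
    | zero =>
      cases q with
      | succ q =>
        obtain ⟨c, hc⟩ := step q 0 (by omega) (fun t => -A t) hA.neg (by simp only [h01])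
          (fun t => (h t).neg)
        have := FH.map (V := UU (m + 1) 0 (q + 1)) (fun A => -A) continuous_neg (by
          intro x hx
          rcases UU_cases (by omega) hx with hx | hx | hx
          · exact Or.inr hx.neg.to_sigCone
          · exact hx.neg.mem_UU
          · exact hx.neg.mem_UU') hc
        exact ⟨-c, by simpa using this⟩
      | zero =>
        have h0 : ∀ t, A t = 0 := by
          intro t
          obtain ⟨v, -, e⟩ := h t
          rw [e, frm]
          simp
        refine ⟨0, FH.mk (fun s t => A t) (hA.comp continuous_snd) (fun s _ _ t => (h t).mem_UU)
          (fun _ => h01) (fun _ => rfl) (fun t => h0 t)⟩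

end Main

theorem cone_loops_nullhomotopic_in_union (n p q : ℕ) (hpq : p + q < n)
    (a : Matrix (Fin n) (Fin n) ℝ) (ha : a ∈ sigCone n p q)
    (γ : Path (⟨a, ha⟩ : sigCone n p q) (⟨a, ha⟩ : sigCone n p q)) :
    Path.Homotopic
      (γ.map (continuous_inclusion
        (show sigCone n p q ⊆ sigCone n (p+1) q ∪ sigCone n p q ∪ sigCone n p (q+1) from
          fun x hx => Or.inl (Or.inr hx))))
      (Path.refl (⟨a, Or.inl (Or.inr ha)⟩ :
        ↥(sigCone n (p+1) q ∪ sigCone n p q ∪ sigCone n p (q+1)))) := by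
  obtain ⟨c, f', g', hf, hg, H⟩ := main_ind n p q hpq
    (fun t => (γ t : Matrix (Fin n) (Fin n) ℝ)) (continuous_subtype_val.comp γ.continuous)
    (by simp) (fun t => Sig.of_sigCone hpq.le (γ t).2)
  refine aux_null (c := g' 0) _ ?_
  convert H using 1
  · ext1 t
    exact Subtype.ext (hf t).symm
  · ext1 t
    exact Subtype.ext ((hg 0).trans (hg t).symm)
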